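/- arXiv:2506.01281 — 5 statements merged into one kernel-verified Lean document; each statement's English description precedes it below -/
import Mathlib

section
/- Let f : (0,∞) → ℝ be convex with f(1) = 0. For every ε > 0 and every K > 1, there exist a finite type Ω and probability distributions P and Q on Ω with P(x) > 0 and Q(x) > 0 for all x, such that D_f(P‖Q) < ε while P(x₀) = K·Q(x₀) for some x₀ ∈ Ω. (Proposition 3.2: a bounded f-divergence does not imply any bound on the relative approximation error.) -/
/-- Proposition 3.2: a bounded `f`-divergence does not imply any bound on the
relative approximation error. For any convex `f` with `f 1 = 0`, any `ε > 0`
and any `K > 1` there are fully supported distributions `P, Q` on a finite type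
with `D_f(P‖Q) < ε` and yet `P x₀ = K * Q x₀` at some point. -/
theorem bounded_fdiv_not_relative_approx (f : ℝ → ℝ)
    (hconv : ConvexOn ℝ (Set.Ioi (0 : ℝ)) f) (hf1 : f 1 = 0)
    (ε K : ℝ) (hε : 0 < ε) (hK : 1 < K) :
    ∃ (Ω : Type) (_ : Fintype Ω) (P Q : Ω → ℝ),
      (∀ x, 0 < P x) ∧ (∑ x, P x = 1) ∧
      (∀ x, 0 < Q x) ∧ (∑ x, Q x = 1) ∧
      (∑ x, Q x * f (P x / Q x)) < ε ∧
      ∃ x₀ : Ω, P x₀ = K * Q x₀ := by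
  have hcont : ContinuousAt f 1 :=
    (hconv.continuousOn isOpen_Ioi).continuousAt (Ioi_mem_nhds one_pos)
  have hratio : ContinuousAt (fun q : ℝ => (1 - K * q) / (1 - q)) 0 := by
    refine ContinuousAt.div (by fun_prop) (by fun_prop) (by norm_num)
  have hf : ContinuousAt (fun q : ℝ => f ((1 - K * q) / (1 - q))) 0 :=
    ContinuousAt.comp (g := f) (by simpa using hcont) hratio
  have hdiv : ContinuousAt
      (fun q : ℝ => q * f K + (1 - q) * f ((1 - K * q) / (1 - q))) 0 :=
    (by fun_prop : ContinuousAt (fun q : ℝ => q * f K) 0).add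
      ((by fun_prop : ContinuousAt (fun q : ℝ => 1 - q) 0).mul hf)
  have hsmall : ∀ᶠ q in nhds (0 : ℝ),
      q * f K + (1 - q) * f ((1 - K * q) / (1 - q)) < ε :=
    hdiv.eventually_lt continuousAt_const (by simpa [hf1] using hε)
  have hmass : ∀ᶠ q in nhds (0 : ℝ), K * q < 1 :=
    ContinuousAt.eventually_lt (by fun_prop) continuousAt_const (by simp)
  obtain ⟨q, ⟨hqε, hKq⟩, hq⟩ :=
    (((hsmall.and hmass).filter_mono nhdsWithin_le_nhds).and
      (self_mem_nhdsWithin (s := Set.Ioi (0 : ℝ)))).exists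
  replace hq : 0 < q := hq
  have hq1 : q < 1 := by nlinarith
  refine ⟨Bool, inferInstance, fun b => cond b (K * q) (1 - K * q),
    fun b => cond b q (1 - q), ?_, ?_, ?_, ?_, ?_, true, rfl⟩
  · rintro (_ | _)
    · exact sub_pos.mpr hKq
    · exact mul_pos (by linarith) hq
  · simp
  · rintro (_ | _)
    · exact sub_pos.mpr hq1
    · exact hq
  · simp
  · simpa [mul_div_cancel_right₀ K hq.ne'] using hqε
end

section
/- Let Ω be a finite type, P a probability distribution on Ω with P(x) > 0 for all x, and A ⊆ Ω an event with δ := P(A) satisfying 0 < δ < 1. Let K > δ. Define Q : Ω → ℝ by Q(x) = P(x)/K for x ∈ A and Q(x) = ((1 − δ/K)/(1 − δ))·P(x) for x ∉ A. Then Q is a probability distribution on Ω with Q(x) > 0 for all x, and for every function f : (0,∞) → ℝ, ∑_{x ∈ Ω} Q(x)·f(P(x)/Q(x)) = (δ/K)·f(K) + (1 − δ/K)·f((1 − δ)/(1 − δ/K)). (Explicit f-divergence computation for the rescaled distribution in the construction of Proposition 3.2.) -/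
/-- Explicit `f`-divergence computation for the rescaled distribution in the
construction of Proposition 3.2. -/
theorem fdiv_of_rescaled_distribution {Ω : Type*} [Fintype Ω] [DecidableEq Ω]
    (P : Ω → ℝ) (hPpos : ∀ x, 0 < P x) (hPsum : ∑ x, P x = 1)
    (A : Finset Ω) (δ : ℝ) (hδ : δ = ∑ x ∈ A, P x)
    (hδ0 : 0 < δ) (hδ1 : δ < 1)
    (K : ℝ) (hK : δ < K)
    (Q : Ω → ℝ)
    (hQ : ∀ x, Q x = if x ∈ A then P x / K else ((1 - δ / K) / (1 - δ)) * P x) :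
    (∀ x, 0 < Q x) ∧ (∑ x, Q x = 1) ∧
      ∀ f : ℝ → ℝ,
        ∑ x, Q x * f (P x / Q x) =
          (δ / K) * f K + (1 - δ / K) * f ((1 - δ) / (1 - δ / K)) := by
  have hK0 : 0 < K := hδ0.trans hK
  have h1δ : 0 < 1 - δ := sub_pos.2 hδ1
  have h1K : 0 < 1 - δ / K := sub_pos.2 ((div_lt_one hK0).2 hK)
  have hQA : ∀ x ∈ A, Q x = P x / K := fun x hx => by rw [hQ, if_pos hx]
  have hQAc : ∀ x ∈ Aᶜ, Q x = (1 - δ / K) / (1 - δ) * P x := fun x hx => by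
    rw [hQ, if_neg (Finset.mem_compl.1 hx)]
  have hPAc : ∑ x ∈ Aᶜ, P x = 1 - δ := by
    rw [hδ, ← hPsum, ← Finset.sum_add_sum_compl A P, add_sub_cancel_left]
  have hQsumA : ∑ x ∈ A, Q x = δ / K := by
    rw [Finset.sum_congr rfl hQA, ← Finset.sum_div, hδ]
  have hQsumAc : ∑ x ∈ Aᶜ, Q x = 1 - δ / K := by
    rw [Finset.sum_congr rfl hQAc, ← Finset.mul_sum, hPAc, div_mul_cancel₀ _ h1δ.ne']
  refine ⟨fun x => ?_, ?_, fun f => ?_⟩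
  · have hx := hPpos x
    rw [hQ]
    split_ifs <;> positivity
  · rw [← Finset.sum_add_sum_compl A Q, hQsumA, hQsumAc, add_sub_cancel]
  · have hsumA : ∑ x ∈ A, Q x * f (P x / Q x) = δ / K * f K := by
      rw [← hQsumA, Finset.sum_mul]
      refine Finset.sum_congr rfl fun x hx => ?_
      rw [hQA x hx, div_div_cancel₀ (hPpos x).ne']
    have hsumAc : ∑ x ∈ Aᶜ, Q x * f (P x / Q x) =
        (∑ x ∈ Aᶜ, Q x) * f ((1 - δ) / (1 - δ / K)) := by
      rw [Finset.sum_mul]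
      refine Finset.sum_congr rfl fun x hx => ?_
      rw [hQAc x hx, div_mul_eq_mul_div, div_div_eq_mul_div, mul_comm (1 - δ / K),
        mul_div_mul_left _ _ (hPpos x).ne']
    rw [← Finset.sum_add_sum_compl A, hsumA, hsumAc, hQsumAc]
end

section
/- Let 0 ≤ ε < 1/8, let f : (Fin n → Bool) → Bool be satisfiable, let P be the uniform distribution on the set of models of f, and let Q be a probability distribution on Fin n → Bool with D_TV(P,Q) < ε. Define g : (Fin n → Bool) → Bool by g(x) = true if and only if Q(x) ≥ 1/2^{n+1}. Then MC(f ∧ ¬g) + MC(¬f ∧ g) < 4ε·2^n; that is, g is a weak 4ε-approximation of f. (Combinatorial core of Proposition 4.3: bounded total variation distance implies weak approximation of the support.) -/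
/-- Combinatorial core of Proposition 4.3: bounded total variation distance
to the uniform distribution over the models of `f` implies that the
high-probability support `g` of `Q` is a weak `4ε`-approximation of `f`. -/
theorem bounded_tvd_implies_weak_approximation {n : ℕ}
    (ε : ℝ) (hε0 : 0 ≤ ε) (hε : ε < 1 / 8)
    (f : (Fin n → Bool) → Bool) (hf : ∃ x, f x = true)
    (P : (Fin n → Bool) → ℝ)
    (hP : ∀ x, P x = if f x = true then
      (((Finset.univ.filter (fun y : Fin n → Bool => f y = true)).card : ℝ))⁻¹
      else 0)
    (Q : (Fin n → Bool) → ℝ)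
    (hQ0 : ∀ x, 0 ≤ Q x) (hQ1 : ∑ x, Q x = 1)
    (hTV : (1 / 2) * (∑ x, |P x - Q x|) < ε)
    (g : (Fin n → Bool) → Bool)
    (hg : ∀ x, g x = true ↔ (1 / 2 ^ (n + 1) : ℝ) ≤ Q x) :
    ((Finset.univ.filter
        (fun x : Fin n → Bool => f x = true ∧ g x = false)).card : ℝ)
      + ((Finset.univ.filter
        (fun x : Fin n → Bool => f x = false ∧ g x = true)).card : ℝ)
      < 4 * ε * 2 ^ n := by
  have hcard_le : ((Finset.univ.filter (fun y : Fin n → Bool => f y = true)).card : ℝ) ≤ 2 ^ n := by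
    exact_mod_cast (Finset.card_filter_le _ _).trans (by simp)
  have hcard_pos :
      (0 : ℝ) < ((Finset.univ.filter (fun y : Fin n → Bool => f y = true)).card : ℝ) := by
    obtain ⟨x, hx⟩ := hf
    exact_mod_cast Finset.card_pos.mpr ⟨x, by simpa using hx⟩
  have hmodel : ((2 : ℝ) ^ n)⁻¹ ≤
      (((Finset.univ.filter (fun y : Fin n → Bool => f y = true)).card : ℝ))⁻¹ :=
    inv_anti₀ hcard_pos hcard_le
  have hhalf : ((2 : ℝ) ^ n)⁻¹ = 2 * (1 / 2 ^ (n + 1)) := by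
    rw [pow_succ]
    field_simp
  have hone : (2 : ℝ) ^ (n + 1) * (1 / 2 ^ (n + 1)) = 1 := by field_simp
  have hpointwise : ∀ x, (if f x = true ∧ g x = false then (1 : ℝ) else 0)
      + (if f x = false ∧ g x = true then (1 : ℝ) else 0) ≤ 2 ^ (n + 1) * |P x - Q x| := by
    intro x
    have hPx := hP x
    have hgx := hg x
    cases hfx : f x <;> cases hgx' : g x <;> simp only [hfx, hgx'] at hPx hgx ⊢ <;> simp at hPx ⊢
    · have hQx := hgx.mp trivial
      calc (1 : ℝ) = 2 ^ (n + 1) * (1 / 2 ^ (n + 1)) := hone.symm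
        _ ≤ 2 ^ (n + 1) * |P x - Q x| := by
          gcongr
          rw [hPx, zero_sub, abs_neg]
          exact hQx.trans (le_abs_self _)
    · have hQx : Q x < 1 / 2 ^ (n + 1) := by
        by_contra! h
        exact absurd (hgx.mpr h) (by simp)
      calc (1 : ℝ) = 2 ^ (n + 1) * (1 / 2 ^ (n + 1)) := hone.symm
        _ ≤ 2 ^ (n + 1) * |P x - Q x| := by
          gcongr
          refine le_trans ?_ (le_abs_self _)
          linarith
  have hsum := Finset.sum_le_sum fun x (_ : x ∈ Finset.univ) => hpointwise x
  rw [Finset.sum_add_distrib, Finset.sum_boole, Finset.sum_boole, ← Finset.mul_sum] at hsum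
  calc _ ≤ (2 : ℝ) ^ (n + 1) * ∑ x, |P x - Q x| := hsum
    _ < 2 ^ (n + 1) * (2 * ε) := by
      gcongr
      linarith
    _ = 4 * ε * 2 ^ n := by ring
end

section
/- Let k > 0 and let f : (0,∞) → ℝ be k-convex on (0,∞) with f(1) = 0. Let P and Q be probability distributions on a finite type Ω with P(x) > 0 and Q(x) > 0 for all x. Then D_TV(P,Q)² ≤ D_f(P‖Q)/k. (The bound on total variation distance by k-convex f-divergences used throughout the paper.) -/
/-- A function satisfying the `k`-convexity inequality on `(0, ∞)` becomes convex there after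
subtracting `k / 2 * x ^ 2`. -/
theorem convexOn_sub_sq_of_kconvex {k : ℝ} {f : ℝ → ℝ}
    (hkconv : ∀ x ∈ Set.Ioi (0 : ℝ), ∀ y ∈ Set.Ioi (0 : ℝ),
      ∀ t ∈ Set.Icc (0 : ℝ) 1,
        f ((1 - t) * x + t * y) ≤
          (1 - t) * f x + t * f y - k * t * (1 - t) * (x - y) ^ 2 / 2) :
    ConvexOn ℝ (Set.Ioi 0) fun x => f x - k / 2 * x ^ 2 := by
  refine ⟨convex_Ioi 0, fun x hx y hy a b ha hb hab => ?_⟩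
  obtain rfl : a = 1 - b := by linarith
  have h := hkconv x hx y hy b ⟨hb, by linarith⟩
  simp only [smul_eq_mul]
  linear_combination h

/-- The `f`-divergence of a `k`-convex `f` dominates `k / 2` times the `χ²`-divergence. -/
theorem chiSq_le_kconvex_fdiv {Ω : Type*} [Fintype Ω] {k : ℝ} {f : ℝ → ℝ}
    (hkconv : ∀ x ∈ Set.Ioi (0 : ℝ), ∀ y ∈ Set.Ioi (0 : ℝ),
      ∀ t ∈ Set.Icc (0 : ℝ) 1,
        f ((1 - t) * x + t * y) ≤
          (1 - t) * f x + t * f y - k * t * (1 - t) * (x - y) ^ 2 / 2)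
    (hf1 : f 1 = 0) {P Q : Ω → ℝ}
    (hP0 : ∀ x, 0 < P x) (hP1 : ∑ x, P x = 1)
    (hQ0 : ∀ x, 0 < Q x) (hQ1 : ∑ x, Q x = 1) :
    k / 2 * ∑ x, (P x - Q x) ^ 2 / Q x ≤ ∑ x, Q x * f (P x / Q x) := by
  have hJ := (convexOn_sub_sq_of_kconvex hkconv).map_sum_le
    (t := Finset.univ) (w := Q) (p := fun x => P x / Q x)
    (fun x _ => (hQ0 x).le) hQ1 (fun x _ => div_pos (hP0 x) (hQ0 x))
  have hmean : ∑ x, Q x * (P x / Q x) = 1 := by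
    rw [← hP1]
    exact Finset.sum_congr rfl fun x _ => mul_div_cancel₀ _ (hQ0 x).ne'
  simp only [smul_eq_mul, hmean, hf1] at hJ
  have hsplit : ∑ x, Q x * (f (P x / Q x) - k / 2 * (P x / Q x) ^ 2) =
      ∑ x, Q x * f (P x / Q x) - k / 2 * ∑ x, (P x - Q x) ^ 2 / Q x
        - k * ∑ x, P x + k / 2 * ∑ x, Q x := by
    simp only [Finset.mul_sum, ← Finset.sum_sub_distrib, ← Finset.sum_add_distrib]
    refine Finset.sum_congr rfl fun x _ => ?_
    have := (hQ0 x).ne'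
    field_simp
    ring
  rw [hsplit, hP1, hQ1] at hJ
  linarith

/-- The bound `D_TV(P,Q)² ≤ D_f(P‖Q) / k` for `k`-convex `f`-divergences. -/
theorem tvd_sq_le_kconvex_fdiv {Ω : Type*} [Fintype Ω]
    (k : ℝ) (hk : 0 < k) (f : ℝ → ℝ)
    (hkconv : ∀ x ∈ Set.Ioi (0 : ℝ), ∀ y ∈ Set.Ioi (0 : ℝ),
      ∀ t ∈ Set.Icc (0 : ℝ) 1,
        f ((1 - t) * x + t * y) ≤
          (1 - t) * f x + t * f y - k * t * (1 - t) * (x - y) ^ 2 / 2)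
    (hf1 : f 1 = 0)
    (P Q : Ω → ℝ)
    (hP0 : ∀ x, 0 < P x) (hP1 : ∑ x, P x = 1)
    (hQ0 : ∀ x, 0 < Q x) (hQ1 : ∑ x, Q x = 1) :
    ((1 / 2) * ∑ x, |P x - Q x|) ^ 2 ≤ (∑ x, Q x * f (P x / Q x)) / k := by
  have hχ := chiSq_le_kconvex_fdiv hkconv hf1 hP0 hP1 hQ0 hQ1
  have hCS := Finset.sq_sum_div_le_sum_sq_div Finset.univ (fun x => |P x - Q x|)
    (g := Q) fun x _ => hQ0 x
  simp only [hQ1, div_one, sq_abs] at hCS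
  rw [le_div_iff₀ hk]
  nlinarith [mul_le_mul_of_nonneg_left hCS hk.le,
    mul_nonneg hk.le (sq_nonneg (∑ x, |P x - Q x|))]
end

section
/- For every ε ∈ (0,1) and every c ∈ (0,1), there exist a finite type Ω, probability distributions P and Q on Ω, an event E ⊆ Ω with P(E) = Q(E) > 0, and a point a ∈ E, such that D_TV(P,Q) < ε and |P({a})/P(E) − Q({a})/Q(E)| ≥ c. (Theorem B.5: bounded total variation distance does not imply absolute approximation of conditional probabilities; the conditional error can be arbitrarily close to 1 even as the total variation distance tends to 0.) -/
/-- Theorem B.5: bounded total variation distance does not imply absolute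
approximation of conditional probabilities. -/
theorem bounded_tvd_not_conditional_approx (ε c : ℝ)
    (hε : ε ∈ Set.Ioo (0 : ℝ) 1) (hc : c ∈ Set.Ioo (0 : ℝ) 1) :
    ∃ (Ω : Type) (_ : Fintype Ω) (P Q : Ω → ℝ) (E : Finset Ω) (a : Ω),
      (∀ x, 0 ≤ P x) ∧ (∑ x, P x = 1) ∧
      (∀ x, 0 ≤ Q x) ∧ (∑ x, Q x = 1) ∧
      a ∈ E ∧
      (∑ x ∈ E, P x) = (∑ x ∈ E, Q x) ∧
      0 < (∑ x ∈ E, P x) ∧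
      (1 / 2) * (∑ x, |P x - Q x|) < ε ∧
      c ≤ |P a / (∑ x ∈ E, P x) - Q a / (∑ x ∈ E, Q x)| := by
  obtain ⟨hε₀, hε₁⟩ := hε
  refine ⟨Fin 3, inferInstance, ![ε / 2, 0, 1 - ε / 2], ![0, ε / 2, 1 - ε / 2], {0, 1}, 0,
    ?_, ?_, ?_, ?_, ?_, ?_, ?_, ?_, ?_⟩
  · intro x
    fin_cases x <;> simp <;> linarith
  · simp [Fin.sum_univ_three]
  · intro x
    fin_cases x <;> simp <;> linarith
  · simp [Fin.sum_univ_three]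
  · simp
  · simp
  · simpa using hε₀
  · simp [Fin.sum_univ_three, abs_of_pos (half_pos hε₀)]
    linarith
  · simpa [hε₀.ne'] using hc.2.le
end
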